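/- (Projection onto log-scale dimension) Let N ≥ 2 and let D = {(x_i, y_i)}_{i=1}^N be a dataset in ℝ^d with separation constant ε_D. Set m := min{ d, max{ ⌈864·log N⌉, ⌈10·log d⌉ } }. Then there exists a 1-Lipschitz linear map φ : ℝ^d → ℝ^m such that the projected dataset D' = {(φ(x_i), y_i)}_{i=1}^N has separation constant ε_{D'} ≥ (5/12)·√(m/d)·ε_D. -/

import Mathlib

/-- The separation constant `ε_D = (1/2) · min{‖x_i - x_j‖ : y_i ≠ y_j}` of a labeled
dataset `(x, y)`. -/
noncomputable def sepConst {E : Type*} [NormedAddCommGroup E] {N : ℕ} {L : Type*}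
    (x : Fin N → E) (y : Fin N → L) : ℝ :=
  (1 / 2) * sInf {r : ℝ | ∃ i j : Fin N, y i ≠ y j ∧ r = ‖x i - x j‖}

noncomputable def radE : (n : ℕ) → ((Fin n → ℝ) → ℝ) → ℝ
  | 0, f => f Fin.elim0
  | n + 1, f => (radE n (fun s => f (Fin.cons 1 s)) + radE n (fun s => f (Fin.cons (-1) s))) / 2

theorem radE_add (n : ℕ) (f g : (Fin n → ℝ) → ℝ) :
    radE n (fun s => f s + g s) = radE n f + radE n g := by
  induction n with
  | zero => rfl
  | succ n ih => simp only [radE, ih]; ring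

theorem radE_const (n : ℕ) (c : ℝ) : radE n (fun _ => c) = c := by
  induction n with
  | zero => rfl
  | succ n ih => simp only [radE, ih]; ring

theorem radE_mul (n : ℕ) (c : ℝ) (f : (Fin n → ℝ) → ℝ) :
    radE n (fun s => c * f s) = c * radE n f := by
  induction n with
  | zero => rfl
  | succ n ih => simp only [radE, ih]; ring

theorem radE_sum {ι : Type*} (S : Finset ι) (n : ℕ) (f : ι → (Fin n → ℝ) → ℝ) :
    radE n (fun s => ∑ i ∈ S, f i s) = ∑ i ∈ S, radE n (f i) := by
  classical
  induction S using Finset.induction_on with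
  | empty => simp [radE_const]
  | insert a S ha ih => simp only [Finset.sum_insert ha, radE_add, ih]

theorem radE_exists (n : ℕ) (f : (Fin n → ℝ) → ℝ) :
    ∃ s : Fin n → ℝ, (∀ i, s i ^ 2 = 1) ∧ f s ≤ radE n f := by
  induction n with
  | zero => exact ⟨Fin.elim0, fun i => i.elim0, le_rfl⟩
  | succ n ih =>
    obtain ⟨s, hs, h1⟩ := ih (fun s => f (Fin.cons 1 s))
    obtain ⟨t, ht, h2⟩ := ih (fun s => f (Fin.cons (-1) s))
    by_cases h : f (Fin.cons 1 s) ≤ f (Fin.cons (-1) t)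
    · refine ⟨Fin.cons 1 s, fun i => ?_, ?_⟩
      · refine Fin.cases ?_ ?_ i <;> simp [hs]
      · simp only [radE]; linarith
    · refine ⟨Fin.cons (-1) t, fun i => ?_, ?_⟩
      · refine Fin.cases ?_ ?_ i <;> simp [ht]
      · simp only [radE]; linarith

theorem radE_sq (n : ℕ) (v : Fin n → ℝ) (a : ℝ) :
    radE n (fun s => (a + ∑ i, s i * v i) ^ 2) = a ^ 2 + ∑ i, v i ^ 2 := by
  induction n generalizing a with
  | zero => simp [radE]
  | succ n ih =>
    have h1 := ih (fun i => v i.succ) (a + v 0)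
    have h2 := ih (fun i => v i.succ) (a - v 0)
    simp only [radE, Fin.sum_univ_succ, Fin.cons_zero, Fin.cons_succ]
    simp only [← add_assoc, one_mul, neg_mul, ← sub_eq_add_neg, h1, h2]
    ring

theorem radE_exp (n : ℕ) (v : Fin n → ℝ) (l a : ℝ) (hl : 0 ≤ l)
    (hv : 2 * l * ∑ i, v i ^ 2 < 1) :
    radE n (fun s => Real.exp (l * (a + ∑ i, s i * v i) ^ 2)) ≤
      Real.exp (l / (1 - 2 * l * ∑ i, v i ^ 2) * (a ^ 2 + ∑ i, v i ^ 2)) := by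
  induction n generalizing a with
  | zero => simp [radE]
  | succ n ih =>
    set T := ∑ i : Fin n, v i.succ ^ 2 with hT
    have hT0 : 0 ≤ T := Finset.sum_nonneg fun i _ => sq_nonneg _
    have hS : ∑ i, v i ^ 2 = v 0 ^ 2 + T := by rw [Fin.sum_univ_succ]
    rw [hS] at hv ⊢
    set b := v 0
    have hb : 0 ≤ l * b ^ 2 := by positivity
    have hlt : 2 * l * T < 1 := by nlinarith
    have h1 := ih (fun i => v i.succ) (a + b) hlt
    have h2 := ih (fun i => v i.succ) (a - b) hlt
    simp only [radE, Fin.sum_univ_succ, Fin.cons_zero, Fin.cons_succ]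
    simp only [← add_assoc, one_mul, neg_mul, ← sub_eq_add_neg]
    simp only [← hT] at h1 h2
    set p := 1 - 2 * l * T with hp
    have hp0 : 0 < p := by linarith
    have hr0 : 0 < p - 2 * l * b ^ 2 := by rw [hp]; linarith
    set μ := l / p with hμ
    have hμ0 : 0 ≤ μ := by positivity
    have hν : l / (1 - 2 * l * (b ^ 2 + T)) = l / (p - 2 * l * b ^ 2) := by
      rw [hp]; congr 1; ring
    rw [hν]
    set ν := l / (p - 2 * l * b ^ 2) with hνd
    have hl1 : l = μ * p := by rw [hμ]; field_simp
    have hl2 : l = ν * (p - 2 * l * b ^ 2) := by rw [hνd]; exact (div_mul_cancel₀ _ hr0.ne').symm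
    have hν0 : 0 ≤ ν := by positivity
    have hμν : μ ≤ ν := by
      rw [hμ, hνd]
      apply div_le_div_of_nonneg_left hl hr0; linarith
    have hkey : μ + 2 * μ ^ 2 * b ^ 2 ≤ ν := by
      -- ν - μ = 2 μ ν b²
      have : ν - μ = 2 * μ * ν * b ^ 2 := by
        have h0 : p * (ν - μ - 2 * μ * ν * b ^ 2) = 0 := by
          linear_combination (-1 : ℝ) * hl2 + (1 + 2 * ν * b ^ 2) * hl1
        rcases mul_eq_zero.1 h0 with h | h
        · exact absurd h hp0.ne'
        · linarith
      nlinarith [mul_nonneg (mul_nonneg hμ0 (sub_nonneg.2 hμν)) (sq_nonneg b)]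
    have hc := Real.cosh_le_exp_half_sq (2 * μ * a * b)
    rw [Real.cosh_eq] at hc
    have e1 : Real.exp (μ * ((a + b) ^ 2 + T)) =
        Real.exp (μ * (a ^ 2 + b ^ 2 + T)) * Real.exp (2 * μ * a * b) := by
      rw [← Real.exp_add]; ring_nf
    have e2 : Real.exp (μ * ((a - b) ^ 2 + T)) =
        Real.exp (μ * (a ^ 2 + b ^ 2 + T)) * Real.exp (-(2 * μ * a * b)) := by
      rw [← Real.exp_add]; ring_nf
    rw [e1] at h1
    rw [e2] at h2
    calc _ ≤ Real.exp (μ * (a ^ 2 + b ^ 2 + T)) *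
          ((Real.exp (2 * μ * a * b) + Real.exp (-(2 * μ * a * b))) / 2) := by linarith
      _ ≤ Real.exp (μ * (a ^ 2 + b ^ 2 + T)) * Real.exp ((2 * μ * a * b) ^ 2 / 2) := by gcongr
      _ ≤ _ := by
        rw [← Real.exp_add]
        apply Real.exp_le_exp.2
        have := mul_le_mul_of_nonneg_right hkey (sq_nonneg a)
        have := mul_le_mul_of_nonneg_right hμν (add_nonneg (sq_nonneg b) hT0)
        nlinarith

theorem exists_proj (n : ℕ) (u : EuclideanSpace ℝ (Fin (n + 1))) (hu : ‖u‖ = 1) :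
    ∃ ψ : EuclideanSpace ℝ (Fin (n + 1)) →ₗ[ℝ] EuclideanSpace ℝ (Fin n),
      ∀ w, ‖ψ w‖ ^ 2 = ‖w‖ ^ 2 - (inner ℝ u w) ^ 2 := by
  have hu0 : u ≠ 0 := by intro h; simp [h] at hu
  have : Fact (Module.finrank ℝ (EuclideanSpace ℝ (Fin (n + 1))) = n + 1) := ⟨by simp⟩
  let B := OrthonormalBasis.fromOrthogonalSpanSingleton (𝕜 := ℝ) n hu0
  refine ⟨B.repr.toLinearEquiv.toLinearMap ∘ₗ
    ((Submodule.span ℝ {u})ᗮ.orthogonalProjectionOnto).toLinearMap, fun w => ?_⟩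
  have h := Submodule.norm_sq_eq_add_norm_sq_projection w (Submodule.span ℝ {u})
  have h2 : ‖(Submodule.span ℝ {u}).orthogonalProjectionOnto w‖ = |inner ℝ u w| := by
    rw [Submodule.coe_norm, ← Submodule.starProjection_apply,
      Submodule.starProjection_unit_singleton ℝ hu, norm_smul, hu, mul_one, Real.norm_eq_abs]
  rw [h2, sq_abs] at h
  have h3 : ‖(B.repr.toLinearEquiv.toLinearMap ∘ₗ
    ((Submodule.span ℝ {u})ᗮ.orthogonalProjectionOnto).toLinearMap) w‖ =
      ‖(Submodule.span ℝ {u})ᗮ.orthogonalProjectionOnto w‖ := B.repr.norm_map _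
  rw [h3]
  linarith

theorem exp_quad (x : ℝ) (hx : 0 ≤ x) :
    Real.exp x ≤ 1 + x + x ^ 2 * Real.exp x / 2 := by
  have hd : ∀ t : ℝ, HasDerivAt (fun t : ℝ => (1 + t) * Real.exp (-t) + t ^ 2 / 2)
      (t * (1 - Real.exp (-t))) t := by
    intro t
    have h1 : HasDerivAt (fun t : ℝ => 1 + t) 1 t := (hasDerivAt_id t).const_add 1
    have h2 : HasDerivAt (fun t : ℝ => Real.exp (-t)) (Real.exp (-t) * (-1)) t :=
      (hasDerivAt_neg t).exp
    have h3 : HasDerivAt (fun t : ℝ => t ^ 2 / 2) (t) t := by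
      have := (hasDerivAt_pow 2 t).div_const 2
      exact this.congr_deriv (by push_cast; ring)
    exact ((h1.mul h2).add h3).congr_deriv (by ring)
  have hmono : MonotoneOn (fun t : ℝ => (1 + t) * Real.exp (-t) + t ^ 2 / 2) (Set.Ici 0) := by
    apply monotoneOn_of_deriv_nonneg (convex_Ici 0)
    · exact fun t _ => (hd t).continuousAt.continuousWithinAt
    · exact fun t _ => (hd t).differentiableAt.differentiableWithinAt
    · intro t ht
      rw [interior_Ici, Set.mem_Ioi] at ht
      rw [(hd t).deriv]
      have : Real.exp (-t) ≤ 1 := Real.exp_le_one_iff.2 (by linarith)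
      exact mul_nonneg ht.le (by linarith)
  have h := hmono (Set.mem_Ici.2 le_rfl) (Set.mem_Ici.2 hx) hx
  simp at h
  have h2 : Real.exp (-x) * Real.exp x = 1 := by rw [← Real.exp_add]; simp
  have h3 := mul_le_mul_of_nonneg_right h (Real.exp_pos x).le
  nlinarith

theorem scalar_bound (k z : ℝ) (q : ℕ) (hk : 0 < k) (hz : 0 ≤ z) (hz2 : z ≤ 1 / 2)
    (hq1 : 1 ≤ q) (hq : (q : ℝ) ≤ k / 100) :
    ((1 - z) ^ q)⁻¹ ≤ 1 + q * z + 78 * (q ^ 2 / k ^ 2) * Real.exp (1 / 4 * (k * z)) := by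
  have hq1' : (1 : ℝ) ≤ q := by exact_mod_cast hq1
  have h1 : (1 - z)⁻¹ ≤ Real.exp (z + z ^ 2) := by
    rw [inv_le_iff_one_le_mul₀ (by linarith)]
    have := Real.add_one_le_exp (z + z ^ 2)
    have := Real.quadratic_le_exp_of_nonneg (x := z + z ^ 2) (by positivity)
    calc (1 : ℝ) ≤ (1 + (z + z ^ 2) + (z + z ^ 2) ^ 2 / 2) * (1 - z) := by
          nlinarith [pow_nonneg hz 3, pow_nonneg hz 4, pow_nonneg hz 2,
            mul_nonneg (pow_nonneg hz 2) (sub_nonneg.2 hz2),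
            mul_nonneg (pow_nonneg hz 3) (sub_nonneg.2 hz2),
            mul_nonneg (pow_nonneg hz 4) (sub_nonneg.2 hz2)]
      _ ≤ _ := by gcongr; linarith
  set x := q * (z + z ^ 2) with hx
  have hx0 : 0 ≤ x := by positivity
  have h2 : ((1 - z) ^ q)⁻¹ ≤ Real.exp x := by
    rw [← inv_pow, hx, Real.exp_nat_mul]
    exact pow_le_pow_left₀ (inv_nonneg.2 (by linarith)) h1 q
  have h3 : Real.exp x ≤ 1 + x + x ^ 2 * Real.exp x / 2 := exp_quad x hx0
  have hx2 : x ≤ 3 / 2 * (q * z) := by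
    rw [hx]; nlinarith [mul_nonneg (mul_nonneg (by linarith : (0:ℝ) ≤ q) hz) (sub_nonneg.2 hz2)]
  have hqz : 0 ≤ q * z := by positivity
  have h4 : x ^ 2 ≤ 9 / 4 * (q * z) ^ 2 := by nlinarith
  have h5 : 3 / 2 * (q * z) ≤ 0.015 * (k * z) := by nlinarith
  set y := k * z with hy
  have hy0 : 0 ≤ y := by positivity
  have h6 : (q * z) ^ 2 = q ^ 2 / k ^ 2 * y ^ 2 := by rw [hy]; field_simp
  have h7 : y ^ 2 ≤ 36.4 * Real.exp (0.235 * y) := by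
    have := Real.quadratic_le_exp_of_nonneg (x := 0.235 * y) (by positivity)
    nlinarith
  have h8 : y ^ 2 * Real.exp x ≤ 36.4 * Real.exp (1 / 4 * y) := by
    calc y ^ 2 * Real.exp x ≤ 36.4 * Real.exp (0.235 * y) * Real.exp (0.015 * y) := by
          gcongr; linarith
      _ = 36.4 * Real.exp (1 / 4 * y) := by rw [mul_assoc, ← Real.exp_add]; ring_nf
  have h9 : 1 ≤ Real.exp x := Real.one_le_exp hx0
  have h10 : q * z ^ 2 ≤ (q * z) ^ 2 * Real.exp x := by
    have : q * z ^ 2 ≤ (q * z) ^ 2 := by nlinarith [mul_nonneg hqz hz]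
    nlinarith [sq_nonneg ((q:ℝ) * z)]
  have h11 : (q * z) ^ 2 * Real.exp x ≤ q ^ 2 / k ^ 2 * (36.4 * Real.exp (1 / 4 * y)) := by
    rw [h6, mul_assoc]; gcongr
  have h12 : x ^ 2 * Real.exp x ≤ 9 / 4 * ((q * z) ^ 2 * Real.exp x) := by
    rw [← mul_assoc]; gcongr
  have h13 : 0 ≤ q ^ 2 / k ^ 2 * Real.exp (1 / 4 * y) := by positivity
  nlinarith

theorem bad_bound (k e c : ℝ) (hk : 600 ≤ k) (hc : c ≤ Real.exp (k / 432)) (he : e = Real.exp (-(k / 8))) :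
    1.65 * (2 * e * c) ≤ 2 * (1 / k ^ 2) := by
  have h1 : e * c ≤ Real.exp (-(0.12 * k)) := by
    calc e * c ≤ e * Real.exp (k / 432) := by rw [he]; gcongr
      _ = Real.exp (-(k / 8) + k / 432) := by rw [he, Real.exp_add]
      _ ≤ _ := Real.exp_le_exp.2 (by linarith)
  have h2 : 1.65 * k ^ 2 ≤ Real.exp (0.12 * k) := by
    have h := Real.pow_div_factorial_le_exp (x := 0.12 * k) (by linarith) 4
    refine le_trans ?_ h
    norm_num [Nat.factorial]
    have : (600:ℝ) ^ 2 ≤ k ^ 2 := by gcongr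
    nlinarith [sq_nonneg k]
  have h3 : Real.exp (-(0.12 * k)) * (1.65 * k ^ 2) ≤ 1 := by
    calc _ ≤ Real.exp (-(0.12 * k)) * Real.exp (0.12 * k) := by gcongr
      _ = 1 := by rw [← Real.exp_add]; simp
  have hk0 : 0 < k ^ 2 := by positivity
  have h4 : 1.65 * Real.exp (-(0.12 * k)) ≤ 1 / k ^ 2 := by
    rw [le_div_iff₀ hk0]; linarith
  linarith

theorem exp_half_le : Real.exp (1 / 2) ≤ 1.65 := by
  have h := Real.exp_one_lt_d9
  have h2 : Real.exp (1 / 2) * Real.exp (1 / 2) = Real.exp 1 := by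
    rw [← Real.exp_add]; norm_num
  nlinarith [Real.exp_pos (1 / 2)]

set_option maxHeartbeats 2000000 in
theorem step {ι : Type*} [Fintype ι] (n q : ℕ) (hn : 599 ≤ n) (hq1 : 1 ≤ q)
    (hq : (q : ℝ) ≤ n / 140) (hcard : (Fintype.card ι : ℝ) ≤ Real.exp (n / 432))
    (w : ι → EuclideanSpace ℝ (Fin (n + 1))) (hw : ∀ i, w i ≠ 0) :
    ∃ ψ : EuclideanSpace ℝ (Fin (n + 1)) →ₗ[ℝ] EuclideanSpace ℝ (Fin n),
      (∀ v, ‖ψ v‖ ≤ ‖v‖) ∧ (∀ i, ψ (w i) ≠ 0) ∧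
      ∑ i, ((‖ψ (w i)‖ ^ 2) ^ q)⁻¹ ≤
        (1 + q / ((n : ℝ) + 1) + 131 * (q ^ 2 / ((n : ℝ) + 1) ^ 2)) *
          ∑ i, ((‖w i‖ ^ 2) ^ q)⁻¹ := by
  have hn' : (599 : ℝ) ≤ n := by exact_mod_cast hn
  have hq1' : (1 : ℝ) ≤ q := by exact_mod_cast hq1
  set k : ℝ := (n : ℝ) + 1 with hk
  have hk0 : 0 < k := by linarith
  set v : ι → Fin (n + 1) → ℝ := fun i j => w i j / ‖w i‖ with hv
  have hwn : ∀ i, 0 < ‖w i‖ := fun i => norm_pos_iff.2 (hw i)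
  have hv1 : ∀ i, ∑ j, v i j ^ 2 = 1 := by
    intro i
    have := EuclideanSpace.real_norm_sq_eq (w i)
    simp only [hv, div_pow, ← Finset.sum_div, ← this]
    exact div_self (pow_pos (hwn i) 2).ne'
  set a : ι → ℝ := fun i => ((‖w i‖ ^ 2) ^ q)⁻¹ with ha
  have ha0 : ∀ i, 0 < a i := fun i => inv_pos.2 (pow_pos (pow_pos (hwn i) 2) q)
  set W := ∑ i, a i with hW
  have hW0 : 0 ≤ W := Finset.sum_nonneg fun i _ => (ha0 i).le
  set e := Real.exp (-(k / 8)) with he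
  have he0 : 0 < e := Real.exp_pos _
  set Y : ι → (Fin (n + 1) → ℝ) → ℝ := fun i s => (0 + ∑ j, s j * v i j) ^ 2 with hY
  set X : ι → (Fin (n + 1) → ℝ) → ℝ := fun i s => Real.exp (1 / 4 * Y i s) with hX
  have hEY : ∀ i, radE (n + 1) (Y i) = 1 := by
    intro i
    rw [hY, radE_sq, hv1]; norm_num
  have hEX : ∀ i, radE (n + 1) (X i) ≤ 1.65 := by
    intro i
    have h := radE_exp (n + 1) (v i) (1 / 4) 0 (by norm_num) (by rw [hv1]; norm_num)
    refine le_trans h (le_trans (le_of_eq ?_) exp_half_le)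
    rw [hv1]; norm_num
  set r : ℝ := (q : ℝ) ^ 2 / k ^ 2 with hr
  have hr0 : 0 ≤ r := by positivity
  clear_value r X Y e W a v k
  set f : (Fin (n + 1) → ℝ) → ℝ := fun s =>
    W + ∑ i, (a i * (q / k) * Y i s + (a i * (78 * r) + 2 * W * e) * X i s) with hf
  have hEf : radE (n + 1) f ≤ (1 + q / k + 131 * r) * W := by
    have h1 : radE (n + 1) f = W + ∑ i, (a i * (q / k) * radE (n + 1) (Y i) +
        (a i * (78 * r) + 2 * W * e) * radE (n + 1) (X i)) := by
      rw [hf, radE_add, radE_const, radE_sum]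
      simp only [radE_add, radE_mul]
    rw [h1]
    have h2 : ∑ i, (a i * (q / k) * radE (n + 1) (Y i) +
        (a i * (78 * r) + 2 * W * e) * radE (n + 1) (X i)) ≤
        ∑ i, (a i * (q / k) + (a i * (78 * r) + 2 * W * e) * 1.65) := by
      apply Finset.sum_le_sum
      intro i _
      rw [hEY, mul_one]
      exact add_le_add le_rfl (mul_le_mul_of_nonneg_left (hEX i) (add_nonneg
        (mul_nonneg (ha0 i).le (by linarith)) (mul_nonneg (by linarith) he0.le)))
    have h3 : ∑ i, (a i * (q / k) + (a i * (78 * r) + 2 * W * e) * 1.65) =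
        W * (q / k) + W * (78 * r) * 1.65 + W * (1.65 * (2 * e * Fintype.card ι)) := by
      simp only [Finset.sum_add_distrib, ← Finset.sum_mul, Finset.sum_const, ← hW,
        Finset.card_univ, nsmul_eq_mul]
      ring
    have h4 := bad_bound k e (Fintype.card ι) (by linarith)
      (hcard.trans (Real.exp_le_exp.2 (by rw [hk]; linarith))) he
    have h5 : 1 / k ^ 2 ≤ r := by
      rw [hr]; gcongr; nlinarith
    have h6 : W * (1.65 * (2 * e * Fintype.card ι)) ≤ W * (2 * r) := by
      apply mul_le_mul_of_nonneg_left _ hW0; linarith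
    have h7 : 0 ≤ W * r := by positivity
    rw [h3] at h2
    nlinarith
  clear_value f
  obtain ⟨s, hs, hfs⟩ := radE_exists (n + 1) f
  have hfs := hfs.trans hEf
  have hqk : q / k ≤ 1 / 140 := by rw [div_le_iff₀ hk0]; linarith
  have hr2 : r ≤ 1 / 19600 := by
    have : r = (q / k) ^ 2 := by rw [hr, div_pow]
    rw [this]
    have : 0 ≤ q / k := by positivity
    nlinarith
  have hX0 : ∀ i, 0 < X i s := fun i => by rw [hX]; exact Real.exp_pos _
  have hY0 : ∀ i, 0 ≤ Y i s := fun i => by rw [hY]; exact sq_nonneg _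
  -- no bad index
  have hgood : ∀ i, Y i s / k ≤ 1 / 2 := by
    intro i
    by_contra hcon
    push Not at hcon
    rw [lt_div_iff₀ hk0] at hcon
    have hWp : 0 < W := by
      rw [hW]
      exact Finset.sum_pos (fun i _ => ha0 i) ⟨i, Finset.mem_univ i⟩
    have h1 : 1 ≤ e * X i s := by
      rw [he, hX, ← Real.exp_add]
      apply Real.one_le_exp; linarith
    have h2 : a i * (q / k) * Y i s + (a i * (78 * r) + 2 * W * e) * X i s ≤
        ∑ i, (a i * (q / k) * Y i s + (a i * (78 * r) + 2 * W * e) * X i s) := by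
      apply Finset.single_le_sum (f := fun i =>
        a i * (q / k) * Y i s + (a i * (78 * r) + 2 * W * e) * X i s) _ (Finset.mem_univ i)
      intro j _
      have := (ha0 j).le
      have := (hX0 j).le
      have := hY0 j
      positivity
    have h3 : 0 ≤ a i * (q / k) * Y i s := by
      have := (ha0 i).le
      have := hY0 i
      positivity
    have h4 : 0 ≤ a i * (78 * r) * X i s := by
      have := (ha0 i).le
      have := (hX0 i).le
      positivity
    have h5 : W * 1 ≤ W * (e * X i s) := by gcongr
    have h6 : (1 + q / k + 131 * r) * W ≤ 2 * W := by gcongr; linarith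
    simp only [hf] at hfs
    nlinarith
  -- the direction
  set u : EuclideanSpace ℝ (Fin (n + 1)) := WithLp.toLp 2 (fun j => s j / Real.sqrt k) with hu
  have hsk : Real.sqrt k ^ 2 = k := Real.sq_sqrt hk0.le
  have hun : ‖u‖ = 1 := by
    have h : ‖u‖ ^ 2 = 1 := by
      rw [EuclideanSpace.real_norm_sq_eq]
      simp only [hu, div_pow, hs, hsk]
      simp
      rw [← hk]; field_simp
    nlinarith [norm_nonneg u]
  obtain ⟨ψ, hψ⟩ := exists_proj n u hun
  have hin : ∀ i, inner ℝ u (w i) ^ 2 = ‖w i‖ ^ 2 * (Y i s / k) := by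
    intro i
    have : inner ℝ u (w i) = ‖w i‖ / Real.sqrt k * (0 + ∑ j, s j * v i j) := by
      rw [PiLp.inner_apply, zero_add, Finset.mul_sum]
      apply Finset.sum_congr rfl
      intro j _
      have := (hwn i).ne'
      simp [hu, hv]
      field_simp
    rw [this, mul_pow, div_pow, hsk]
    simp only [hY]; ring
  have hn2 : ∀ i, ‖ψ (w i)‖ ^ 2 = ‖w i‖ ^ 2 * (1 - Y i s / k) := by
    intro i; rw [hψ, hin]; ring
  refine ⟨ψ, fun x => ?_, fun i h0 => ?_, ?_⟩
  · apply le_of_sq_le_sq _ (norm_nonneg _)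
    rw [hψ]; nlinarith [sq_nonneg (inner ℝ u x)]
  · have := hn2 i
    rw [h0, norm_zero] at this
    have h2 := mul_pos (pow_pos (hwn i) 2) (by linarith [hgood i] : 0 < 1 - Y i s / k)
    norm_num at this
    rcases this with h | h
    · exact hw i h
    · linarith [hgood i]
  · refine le_trans ?_ hfs
    simp only [hf]
    rw [hW, ← Finset.sum_add_distrib]
    apply Finset.sum_le_sum
    intro i _
    have hsb := scalar_bound k (Y i s / k) q hk0 (div_nonneg (hY0 i) hk0.le) (hgood i) hq1
      (by linarith)
    have h1 : k * (Y i s / k) = Y i s := by field_simp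
    rw [h1, ← hr] at hsb
    rw [hn2, mul_pow, mul_inv]
    have h2 := mul_le_mul_of_nonneg_left hsb (ha0 i).le
    have h3 : 0 ≤ 2 * W * e * X i s := by have := (hX0 i).le; positivity
    have h4 : (q : ℝ) * (Y i s / k) = q / k * Y i s := by ring
    rw [h4] at h2
    simp only [hX, ha] at h2 h3 ⊢
    simp only [ha] at hW
    rw [← hW]
    linarith

theorem factor_bound (n : ℝ) (q : ℕ) (hn : 1 ≤ n) :
    1 + q / (n + 1) + 131 * ((q : ℝ) ^ 2 / (n + 1) ^ 2) ≤
      Real.exp (q * (Real.log (n + 1) - Real.log n) + 131 * q ^ 2 * (1 / n - 1 / (n + 1))) := by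
  have h1 : 1 / (n + 1) ≤ Real.log (n + 1) - Real.log n := by
    have h := Real.one_sub_inv_le_log_of_pos (x := (n + 1) / n) (by positivity)
    rw [Real.log_div (by positivity) (by positivity)] at h
    refine le_trans (le_of_eq ?_) h
    field_simp; ring
  have h2 : 1 / (n + 1) ^ 2 ≤ 1 / n - 1 / (n + 1) := by
    have : 1 / n - 1 / (n + 1) = 1 / (n * (n + 1)) := by field_simp; ring
    rw [this]
    apply one_div_le_one_div_of_le (by positivity)
    nlinarith
  have h3 := mul_le_mul_of_nonneg_left h1 (Nat.cast_nonneg (α := ℝ) q)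
  have h4 := mul_le_mul_of_nonneg_left h2 (by positivity : 0 ≤ 131 * (q : ℝ) ^ 2)
  refine le_trans ?_ (Real.add_one_le_exp _)
  have h5 : (q : ℝ) * (1 / (n + 1)) = q / (n + 1) := by ring
  have h6 : 131 * (q : ℝ) ^ 2 * (1 / (n + 1) ^ 2) = 131 * ((q : ℝ) ^ 2 / (n + 1) ^ 2) := by ring
  linarith

theorem iter {ι : Type*} [Fintype ι] (m q : ℕ) (hm : 599 ≤ m) (hq1 : 1 ≤ q)
    (hq : (q : ℝ) ≤ m / 140) (hcard : (Fintype.card ι : ℝ) ≤ Real.exp (m / 432)) (t : ℕ)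
    (w : ι → EuclideanSpace ℝ (Fin (m + t))) (hw : ∀ i, w i ≠ 0) :
    ∃ ψ : EuclideanSpace ℝ (Fin (m + t)) →ₗ[ℝ] EuclideanSpace ℝ (Fin m),
      (∀ v, ‖ψ v‖ ≤ ‖v‖) ∧ (∀ i, ψ (w i) ≠ 0) ∧
      ∑ i, ((‖ψ (w i)‖ ^ 2) ^ q)⁻¹ ≤
        Real.exp (q * (Real.log ((m : ℝ) + t) - Real.log m) +
          131 * q ^ 2 * (1 / (m : ℝ) - 1 / ((m : ℝ) + t))) *
          ∑ i, ((‖w i‖ ^ 2) ^ q)⁻¹ := by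
  induction t with
  | zero => exact ⟨LinearMap.id, fun v => le_rfl, hw, by simp⟩
  | succ t ih =>
    have ht : (0 : ℝ) ≤ t := Nat.cast_nonneg t
    have hm' : (599 : ℝ) ≤ m := by exact_mod_cast hm
    obtain ⟨ψ₁, h1, h2, h3⟩ := step (m + t) q (by omega) hq1 (by push_cast; linarith)
      (hcard.trans (Real.exp_le_exp.2 (by push_cast; linarith))) w hw
    obtain ⟨ψ₂, g1, g2, g3⟩ := ih (fun i => ψ₁ (w i)) h2
    refine ⟨ψ₂ ∘ₗ ψ₁, fun v => (g1 _).trans (h1 v), g2, ?_⟩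
    refine le_trans g3 ?_
    have hfb := factor_bound ((m : ℝ) + t) q (by linarith)
    have hS : 0 ≤ ∑ i, ((‖w i‖ ^ 2) ^ q)⁻¹ := Finset.sum_nonneg fun i _ => by positivity
    push_cast at h3 ⊢
    calc _ ≤ _ := mul_le_mul_of_nonneg_left
          (h3.trans (mul_le_mul_of_nonneg_right hfb hS)) (Real.exp_pos _).le
      _ = _ := by
        rw [← mul_assoc, ← Real.exp_add, ← add_assoc (m : ℝ) t 1]
        congr 2
        ring

theorem proj_exists {ι : Type*} [Fintype ι] (m d : ℕ) (hm : 599 ≤ m) (hmd : m ≤ d)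
    (hcard : (Fintype.card ι : ℝ) ≤ Real.exp (m / 432))
    (w : ι → EuclideanSpace ℝ (Fin d)) (hw : ∀ i, w i ≠ 0) :
    ∃ ψ : EuclideanSpace ℝ (Fin d) →ₗ[ℝ] EuclideanSpace ℝ (Fin m),
      (∀ v, ‖ψ v‖ ≤ ‖v‖) ∧ ∀ i, 5 / 12 * Real.sqrt ((m : ℝ) / d) * ‖w i‖ ≤ ‖ψ (w i)‖ := by
  obtain ⟨t, rfl⟩ := Nat.exists_eq_add_of_le hmd
  have hm' : (599 : ℝ) ≤ m := by exact_mod_cast hm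
  have hm0 : (0 : ℝ) < m := by linarith
  set q := m / 150 with hqd
  have hq1 : 1 ≤ q := by omega
  have hqu : (q : ℝ) ≤ m / 150 := by
    rw [le_div_iff₀ (by norm_num)]; exact_mod_cast Nat.div_mul_le_self m 150
  have hql : (m : ℝ) / 201 ≤ q := by
    have h : m ≤ 150 * q + 149 := by omega
    have h' : (m : ℝ) ≤ 150 * q + 149 := by exact_mod_cast h
    linarith
  have hwn : ∀ i, 0 < ‖w i‖ := fun i => norm_pos_iff.2 (hw i)
  obtain ⟨ψ, h1, h2, h3⟩ := iter m q hm hq1 (by linarith) hcard t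
    (fun i => (‖w i‖)⁻¹ • w i) (fun i => smul_ne_zero (inv_ne_zero (hwn i).ne') (hw i))
  refine ⟨ψ, h1, fun i => ?_⟩
  have hsum : ∑ i, ((‖(‖w i‖)⁻¹ • w i‖ ^ 2) ^ q)⁻¹ = (Fintype.card ι : ℝ) := by
    have : ∀ i, ‖(‖w i‖)⁻¹ • w i‖ = 1 := by
      intro i
      rw [norm_smul, norm_inv, norm_norm, inv_mul_cancel₀ (hwn i).ne']
    simp [this]
  rw [hsum] at h3
  set D : ℝ := (m : ℝ) + t with hD
  have hD0 : 0 < D := by positivity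
  set p := ‖ψ ((‖w i‖)⁻¹ • w i)‖ ^ 2 with hp
  have hp0 : 0 < p := pow_pos (norm_pos_iff.2 (h2 i)) 2
  have h4 : (p ^ q)⁻¹ ≤ Real.exp (q * (Real.log D - Real.log m) +
      131 * q ^ 2 * (1 / (m : ℝ) - 1 / D)) * Fintype.card ι := by
    refine le_trans ?_ h3
    exact Finset.single_le_sum (f := fun i => ((‖ψ ((‖w i‖)⁻¹ • w i)‖ ^ 2) ^ q)⁻¹)
      (fun j _ => by positivity) (Finset.mem_univ i)
  have hnum : 131 * (q : ℝ) ^ 2 * (1 / (m : ℝ) - 1 / D) + m / 432 ≤ q * (3 / 2) := by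
    have a1 : 131 * (q : ℝ) ^ 2 * (1 / (m : ℝ) - 1 / D) ≤ 131 * (q : ℝ) ^ 2 * (1 / (m : ℝ)) := by
      apply mul_le_mul_of_nonneg_left _ (by positivity)
      have : 0 ≤ 1 / D := by positivity
      linarith
    have a2 : 131 * (q : ℝ) ^ 2 * (1 / (m : ℝ)) + m / 432 ≤ q * (3 / 2) := by
      have : 131 * (q : ℝ) ^ 2 * (1 / (m : ℝ)) + m / 432 =
        (131 * (q : ℝ) ^ 2 + m * m / 432) / m := by field_simp
      rw [this, div_le_iff₀ hm0]
      nlinarith [mul_nonneg (sub_nonneg.2 hqu) (sub_nonneg.2 hql)]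
    linarith
  have hlog : (3 / 2 : ℝ) ≤ Real.log (144 / 25) := by
    rw [Real.le_log_iff_exp_le (by norm_num)]
    have e1 := Real.exp_one_lt_d9
    have e2 : Real.exp (3 / 2) = Real.exp 1 * Real.exp (1 / 2) := by
      rw [← Real.exp_add]; norm_num
    have e3 := exp_half_le
    rw [e2]
    nlinarith [Real.exp_pos (1 / 2)]
  have h5 : (p ^ q)⁻¹ ≤ ((144 / 25) * (D / m)) ^ q := by
    calc (p ^ q)⁻¹ ≤ _ := h4
      _ ≤ Real.exp (q * (Real.log D - Real.log m) +
          131 * q ^ 2 * (1 / (m : ℝ) - 1 / D)) * Real.exp (m / 432) := by gcongr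
      _ ≤ Real.exp (q * Real.log ((144 / 25) * (D / m))) := by
        rw [← Real.exp_add, Real.log_mul (by norm_num) (by positivity),
          Real.log_div hD0.ne' hm0.ne']
        apply Real.exp_le_exp.2
        have := mul_le_mul_of_nonneg_left hlog (Nat.cast_nonneg (α := ℝ) q)
        linarith
      _ = _ := by rw [Real.exp_nat_mul, Real.exp_log (by positivity)]
  rw [← inv_pow] at h5
  have h6 : p⁻¹ ≤ (144 / 25) * (D / m) := le_of_pow_le_pow_left₀ (by omega) (by positivity) h5
  have h7 : 25 / 144 * (m / D) ≤ p := by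
    rw [inv_le_comm₀ hp0 (by positivity)] at h6
    refine le_trans (le_of_eq ?_) h6
    field_simp
  have h8 : p = ‖ψ (w i)‖ ^ 2 / ‖w i‖ ^ 2 := by
    rw [hp, map_smul, norm_smul, norm_inv, norm_norm]; field_simp
  rw [h8, le_div_iff₀ (pow_pos (hwn i) 2)] at h7
  apply le_of_sq_le_sq _ (norm_nonneg _)
  push_cast
  rw [← hD, mul_pow, mul_pow, Real.sq_sqrt (by positivity)]
  linarith

/-- **Projection onto log-scale dimension.** For a dataset
`D = {(x_i, y_i)}` in `ℝ^d` with `N ≥ 2`, setting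
`m := min{d, max{⌈864 log N⌉, ⌈10 log d⌉}}`, there is a 1-Lipschitz linear map
`φ : ℝ^d → ℝ^m` such that the projected dataset has separation
`ε_{D'} ≥ (5/12) √(m/d) ε_D`. -/
theorem projection_log_scale_dimension
    (d N C : ℕ) (hN : 2 ≤ N)
    (x : Fin N → EuclideanSpace ℝ (Fin d)) (y : Fin N → Fin C)
    (hinj : Function.Injective x) (hlabels : ∃ i j : Fin N, y i ≠ y j)
    (m : ℕ) (hm : m = min d (max ⌈(864 : ℝ) * Real.log N⌉₊ ⌈(10 : ℝ) * Real.log d⌉₊)) :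
    ∃ φ : EuclideanSpace ℝ (Fin d) →ₗ[ℝ] EuclideanSpace ℝ (Fin m),
      (∀ v : EuclideanSpace ℝ (Fin d), ‖φ v‖ ≤ ‖v‖) ∧
      (5 / 12) * Real.sqrt ((m : ℝ) / d) * sepConst x y ≤
        sepConst (fun i : Fin N => φ (x i)) y := by
  suffices h : ∃ φ : EuclideanSpace ℝ (Fin d) →ₗ[ℝ] EuclideanSpace ℝ (Fin m),
      (∀ v, ‖φ v‖ ≤ ‖v‖) ∧ ∀ i j, i ≠ j →
        (5 / 12) * Real.sqrt ((m : ℝ) / d) * ‖x i - x j‖ ≤ ‖φ (x i - x j)‖ by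
    obtain ⟨φ, h1, h2⟩ := h
    refine ⟨φ, h1, ?_⟩
    unfold sepConst
    rw [mul_left_comm]
    apply mul_le_mul_of_nonneg_left _ (by norm_num)
    apply le_csInf
    · obtain ⟨i, j, hij⟩ := hlabels
      exact ⟨_, i, j, hij, rfl⟩
    · rintro r ⟨i, j, hij, rfl⟩
      rw [← map_sub]
      refine le_trans ?_ (h2 i j (fun h => hij (by rw [h])))
      apply mul_le_mul_of_nonneg_left _ (by positivity)
      apply csInf_le
      · refine ⟨0, ?_⟩
        rintro r ⟨_, _, _, rfl⟩
        exact norm_nonneg _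
      · exact ⟨i, j, hij, rfl⟩
  by_cases hmd : m = d
  · subst hmd
    refine ⟨LinearMap.id, fun v => le_rfl, fun i j _ => ?_⟩
    have h1 : Real.sqrt ((m : ℝ) / m) ≤ 1 := by
      rw [Real.sqrt_le_left (by norm_num)]; simpa using div_self_le_one _
    have h2 := norm_nonneg (x i - x j)
    simp only [LinearMap.id_apply]
    nlinarith
  have hle : m ≤ d := hm ▸ min_le_left _ _
  have hm2 : ⌈(864 : ℝ) * Real.log N⌉₊ ≤ m := by
    rcases le_total d (max ⌈(864 : ℝ) * Real.log N⌉₊ ⌈(10 : ℝ) * Real.log d⌉₊) with h | h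
    · rw [min_eq_left h] at hm; exact absurd hm hmd
    · rw [min_eq_right h] at hm; rw [hm]; exact le_max_left _ _
  have hm3 : (864 : ℝ) * Real.log N ≤ m := Nat.ceil_le.1 hm2
  have hN' : (2 : ℝ) ≤ N := by exact_mod_cast hN
  have hlog : Real.log 2 ≤ Real.log N := Real.log_le_log (by norm_num) hN'
  have hm599 : 599 ≤ m := by
    have h2 := Real.log_two_gt_d9
    have : (598 : ℝ) < m := by linarith
    have : 598 < m := by exact_mod_cast this
    omega
  have hcard : (Fintype.card {p : Fin N × Fin N // p.1 ≠ p.2} : ℝ) ≤ Real.exp (m / 432) := by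
    have h1 : Fintype.card {p : Fin N × Fin N // p.1 ≠ p.2} ≤ N * N := by
      refine (Fintype.card_subtype_le _).trans ?_
      simp
    have h2 : (Fintype.card {p : Fin N × Fin N // p.1 ≠ p.2} : ℝ) ≤ N * N := by exact_mod_cast h1
    have hN0 : (0 : ℝ) < N := by linarith
    calc _ ≤ (N * N : ℝ) := h2
      _ = Real.exp (Real.log N + Real.log N) := by rw [Real.exp_add, Real.exp_log hN0]
      _ ≤ _ := Real.exp_le_exp.2 (by linarith)
  obtain ⟨ψ, h1, h2⟩ := proj_exists m d hm599 hle hcard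
    (fun p : {p : Fin N × Fin N // p.1 ≠ p.2} => x p.1.1 - x p.1.2)
    (fun p => sub_ne_zero.2 fun h => p.2 (hinj h))
  exact ⟨ψ, h1, fun i j hij => h2 ⟨(i, j), hij⟩⟩
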